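/- Assume init j ≥ 0 for every j and every amount occurring in every list T p is nonnegative. Call a valid processing sequence S maximal if there is no event e not occurring in S such that S ++ [e] is valid. Then any two maximal valid processing sequences contain exactly the same set of events, and consequently for every process j : Fin n the final account values acc(j, ·) computed from their induced transfer lists coincide. -/

import Mathlib

/-- A money transfer: sender `s`, receiver `r`, amount `v`. -/
structure Transfer (n : ℕ) where
  s : Fin n
  r : Fin n
  v : ℤ

/-- Total money transferred to `j` in `L`. -/
def plus {n : ℕ} (j : Fin n) (L : List (Transfer n)) : ℤ :=
  ((L.filter (fun t => decide (t.r = j))).map (fun t => t.v)).sum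

/-- Total money transferred from `j` in `L`. -/
def minus {n : ℕ} (j : Fin n) (L : List (Transfer n)) : ℤ :=
  ((L.filter (fun t => decide (t.s = j))).map (fun t => t.v)).sum

/-- The value of `j`'s account after the transfers of `L`. -/
def acc {n : ℕ} (init : Fin n → ℤ) (j : Fin n) (L : List (Transfer n)) : ℤ :=
  init j + plus j L - minus j L

/-- The transfer induced by the event `(p, m)`: sender `p`, receiver and
amount given by the `m`-th transfer issued by `p` (i.e. the `m`-th entry
of `T p`). -/
def inducedTransfer {n : ℕ} (T : Fin n → List (Fin n × ℤ)) (e : Fin n × ℕ) :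
    Transfer n :=
  { s := e.1
    r := ((T e.1).getD e.2 (e.1, 0)).1
    v := ((T e.1).getD e.2 (e.1, 0)).2 }

/-- The induced transfer list of a processing sequence. -/
def inducedList {n : ℕ} (T : Fin n → List (Fin n × ℤ))
    (S : List (Fin n × ℕ)) : List (Transfer n) :=
  S.map (inducedTransfer T)

/-- `S` is a processing sequence: a duplicate-free list of events,
where an event is a pair `(p, m)` with `m < (T p).length`. -/
def IsProcSeq {n : ℕ} (T : Fin n → List (Fin n × ℤ))
    (S : List (Fin n × ℕ)) : Prop :=
  S.Nodup ∧ ∀ e ∈ S, e.2 < (T e.1).length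

/-- FIFO condition: whenever the event `(p, m)` occurs at some position of
`S`, every event `(p, m')` with `m' < m` occurs at an earlier position. -/
def FIFO {n : ℕ} (S : List (Fin n × ℕ)) : Prop :=
  ∀ (z : ℕ) (hz : z < S.length) (m' : ℕ), m' < (S[z]'hz).2 →
    ∃ (z' : ℕ) (hz' : z' < S.length), z' < z ∧ (S[z']'hz') = ((S[z]'hz).1, m')

/-- Balance condition: whenever an event occurs at position `z` of `S`, the
amount of its induced transfer is at most the sender's account computed from
the induced transfer list of the first `z` entries of `S`. -/
def Balance {n : ℕ} (init : Fin n → ℤ) (T : Fin n → List (Fin n × ℤ))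
    (S : List (Fin n × ℕ)) : Prop :=
  ∀ (z : ℕ) (hz : z < S.length),
    (inducedTransfer T (S[z]'hz)).v ≤
      acc init (S[z]'hz).1 (inducedList T (S.take z))

/-- A valid processing sequence. -/
def Valid {n : ℕ} (init : Fin n → ℤ) (T : Fin n → List (Fin n × ℤ))
    (S : List (Fin n × ℕ)) : Prop :=
  IsProcSeq T S ∧ FIFO S ∧ Balance init T S

/-- A valid processing sequence is maximal if it cannot be extended by any
further event while remaining valid. -/
def MaximalValid {n : ℕ} (init : Fin n → ℤ) (T : Fin n → List (Fin n × ℤ))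
    (S : List (Fin n × ℕ)) : Prop :=
  Valid init T S ∧ ∀ e : Fin n × ℕ, e ∉ S → ¬ Valid init T (S ++ [e])

theorem plus_inducedList {n : ℕ} (T : Fin n → List (Fin n × ℤ)) {S : List (Fin n × ℕ)}
    (hS : S.Nodup) (j : Fin n) :
    plus j (inducedList T S) =
      ∑ e ∈ S.toFinset with (inducedTransfer T e).r = j, (inducedTransfer T e).v := by
  have h : ({e ∈ S.toFinset | (inducedTransfer T e).r = j} : Finset (Fin n × ℕ)) =
      (S.filter fun e => decide ((inducedTransfer T e).r = j)).toFinset := by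
    ext e
    simp
  rw [h, List.sum_toFinset _ (hS.filter _)]
  simp [plus, inducedList, List.filter_map, Function.comp_def]

theorem minus_inducedList {n : ℕ} (T : Fin n → List (Fin n × ℤ)) {S : List (Fin n × ℕ)}
    (hS : S.Nodup) (j : Fin n) :
    minus j (inducedList T S) =
      ∑ e ∈ S.toFinset with e.1 = j, (inducedTransfer T e).v := by
  have h : ({e ∈ S.toFinset | e.1 = j} : Finset (Fin n × ℕ)) =
      (S.filter fun e => decide (e.1 = j)).toFinset := by
    ext e
    simp
  rw [h, List.sum_toFinset _ (hS.filter _)]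
  simp [minus, inducedList, List.filter_map, Function.comp_def, inducedTransfer]

theorem inducedTransfer_v_nonneg {n : ℕ} {T : Fin n → List (Fin n × ℤ)}
    (hT : ∀ p : Fin n, ∀ x ∈ T p, 0 ≤ x.2) (e : Fin n × ℕ) : 0 ≤ (inducedTransfer T e).v := by
  by_cases h : e.2 < (T e.1).length
  · simpa [inducedTransfer, h] using hT e.1 _ (List.getElem_mem h)
  · simp [inducedTransfer, List.getElem?_eq_none (not_lt.mp h)]

/-- Additional events not sent by `p` can only increase the account of `p`. -/
theorem acc_inducedList_le_of_subset {n : ℕ} (init : Fin n → ℤ) {T : Fin n → List (Fin n × ℤ)}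
    (hT : ∀ p : Fin n, ∀ x ∈ T p, 0 ≤ x.2) {A B : List (Fin n × ℕ)} (hA : A.Nodup) (hB : B.Nodup)
    (hAB : A ⊆ B) {p : Fin n} (hp : ∀ e ∈ B, e.1 = p → e ∈ A) :
    acc init p (inducedList T A) ≤ acc init p (inducedList T B) := by
  have h_minus : minus p (inducedList T A) = minus p (inducedList T B) := by
    rw [minus_inducedList T hA, minus_inducedList T hB]
    congr 1
    ext e
    simp only [Finset.mem_filter, List.mem_toFinset]
    exact ⟨fun h => ⟨hAB h.1, h.2⟩, fun h => ⟨hp e h.1 h.2, h.2⟩⟩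
  have h_plus : plus p (inducedList T A) ≤ plus p (inducedList T B) := by
    rw [plus_inducedList T hA, plus_inducedList T hB]
    refine Finset.sum_le_sum_of_subset_of_nonneg (fun e => ?_)
      fun e _ _ => inducedTransfer_v_nonneg hT e
    simp only [Finset.mem_filter, List.mem_toFinset]
    exact fun h => ⟨hAB h.1, h.2⟩
  unfold acc
  linarith

theorem FIFO.mem_of_lt {n : ℕ} {S : List (Fin n × ℕ)} (hS : FIFO S) {p : Fin n} {m m' : ℕ}
    (h : (p, m) ∈ S) (hm : m' < m) : (p, m') ∈ S := by
  obtain ⟨z, hz, hze⟩ := List.getElem_of_mem h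
  obtain ⟨z', hz', -, h'⟩ := hS z hz m' (by rw [hze]; exact hm)
  rw [hze] at h'
  exact h' ▸ List.getElem_mem hz'

theorem Valid.append_singleton {n : ℕ} {init : Fin n → ℤ} {T : Fin n → List (Fin n × ℤ)}
    {S : List (Fin n × ℕ)} (hS : Valid init T S) {e : Fin n × ℕ} (he : e ∉ S)
    (hlen : e.2 < (T e.1).length) (hfifo : ∀ m' < e.2, (e.1, m') ∈ S)
    (hbal : (inducedTransfer T e).v ≤ acc init e.1 (inducedList T S)) :
    Valid init T (S ++ [e]) := by
  obtain ⟨⟨hnd, hev⟩, hF, hB⟩ := hS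
  refine ⟨⟨by simpa using List.Nodup.concat he hnd, ?_⟩, ?_, ?_⟩
  · intro x hx
    rcases List.mem_append.mp hx with hx | hx
    · exact hev x hx
    · rw [List.mem_singleton.mp hx]
      exact hlen
  · intro z hz m' hm'
    by_cases hzS : z < S.length
    · rw [List.getElem_append_left hzS] at hm' ⊢
      obtain ⟨z', hz', hlt, h'⟩ := hF z hzS m' hm'
      exact ⟨z', by simp; omega, hlt, by rw [List.getElem_append_left hz', h']⟩
    · obtain rfl : z = S.length := by simp at hz; omega
      simp only [List.getElem_concat_length] at hm' ⊢
      obtain ⟨z', hz', h'⟩ := List.getElem_of_mem (hfifo m' hm')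
      exact ⟨z', by simp; omega, hz', by rw [List.getElem_append_left hz', h']⟩
  · intro z hz
    by_cases hzS : z < S.length
    · rw [List.getElem_append_left hzS, List.take_append_of_le_length hzS.le]
      exact hB z hzS
    · obtain rfl : z = S.length := by simp at hz; omega
      simpa using hbal

/-- A maximal valid sequence contains every event of every valid sequence. -/
theorem MaximalValid.subset_of_valid {n : ℕ} {init : Fin n → ℤ} {T : Fin n → List (Fin n × ℤ)}
    (hT : ∀ p : Fin n, ∀ x ∈ T p, 0 ≤ x.2) {S S' : List (Fin n × ℕ)}
    (hS : MaximalValid init T S) (hS' : Valid init T S') : S' ⊆ S := by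
  obtain ⟨hV, hmax⟩ := hS
  obtain ⟨⟨hnd', hev'⟩, hF', hB'⟩ := hS'
  have key : ∀ z, ∀ hz : z < S'.length, S'[z] ∈ S := by
    intro z
    induction z using Nat.strong_induction_on with
    | _ z ih =>
      intro hz
      by_contra hnot
      have h_sub : S'.take z ⊆ S := by
        intro x hx
        obtain ⟨i, hi, rfl⟩ := List.mem_take_iff_getElem.mp hx
        exact ih i (by omega) (by omega)
      have h_prev : ∀ m' < S'[z].2, (S'[z].1, m') ∈ S'.take z := by
        intro m' hm'
        obtain ⟨z', hz', hlt, h'⟩ := hF' z hz m' hm'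
        exact List.mem_take_iff_getElem.mpr ⟨z', by omega, h'⟩
      refine hmax _ hnot (hV.append_singleton hnot (hev' _ (List.getElem_mem hz))
        (fun m' hm' => h_sub (h_prev m' hm')) ((hB' z hz).trans ?_))
      refine acc_inducedList_le_of_subset init hT (hnd'.sublist (List.take_sublist z S'))
        hV.1.1 h_sub ?_
      rintro ⟨q, k⟩ hk rfl
      refine h_prev k ?_
      by_contra! hle
      rcases hle.eq_or_lt with heq | hlt
      · exact hnot (by simpa [← heq] using hk)
      · exact hnot (hV.2.1.mem_of_lt hk hlt)
  intro e he
  obtain ⟨z, hz, rfl⟩ := List.getElem_of_mem he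
  exact key z hz

/-- any two maximal valid processing sequences contain exactly
the same events, and all final account values computed from their induced
transfer lists coincide. -/
theorem maximal_same_events_same_acc (n : ℕ) (init : Fin n → ℤ)
    (T : Fin n → List (Fin n × ℤ))
    (hinit : ∀ j, 0 ≤ init j) (hT : ∀ p : Fin n, ∀ x ∈ T p, 0 ≤ x.2)
    (S S' : List (Fin n × ℕ))
    (hS : MaximalValid init T S) (hS' : MaximalValid init T S') :
    (∀ e : Fin n × ℕ, e ∈ S ↔ e ∈ S') ∧
    (∀ j : Fin n, acc init j (inducedList T S) = acc init j (inducedList T S')) := by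
  have h₁ : S' ⊆ S := hS.subset_of_valid hT hS'.1
  have h₂ : S ⊆ S' := hS'.subset_of_valid hT hS.1
  refine ⟨fun e => ⟨@h₂ e, @h₁ e⟩, fun j => le_antisymm ?_ ?_⟩
  · exact acc_inducedList_le_of_subset init hT hS.1.1.1 hS'.1.1.1 h₂ fun e he _ => h₁ he
  · exact acc_inducedList_le_of_subset init hT hS'.1.1.1 hS.1.1.1 h₁ fun e he _ => h₂ he
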